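/- Let G : ℝ² → ℝ² be a continuously differentiable unipotent map which is fixed point free. Then G is topologically conjugate to the translation τ(x,y) = (x + 1, y): there exists a homeomorphism φ : ℝ² → ℝ² such that φ(G(z)) = τ(φ(z)) for all z ∈ ℝ². -/

import Mathlib

open Filter Topology

/-- A differentiable planar map is *unipotent* if at every point the Jacobian has
both eigenvalues equal to `1`; equivalently the trace of the Jacobian is `2` and
its determinant is `1` everywhere. -/
def Unipotent (G : ℝ × ℝ → ℝ × ℝ) : Prop :=
  ∀ z : ℝ × ℝ,
    (fderiv ℝ G z (1, 0)).1 + (fderiv ℝ G z (0, 1)).2 = 2 ∧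
    (fderiv ℝ G z (1, 0)).1 * (fderiv ℝ G z (0, 1)).2 -
      (fderiv ℝ G z (0, 1)).1 * (fderiv ℝ G z (1, 0)).2 = 1

/-- A planar map is *nonlinear* if its derivative is not constant, i.e. it is not affine. -/
def NonlinearMap (G : ℝ × ℝ → ℝ × ℝ) : Prop :=
  ¬ ∃ A : (ℝ × ℝ) →L[ℝ] ℝ × ℝ, ∀ z : ℝ × ℝ, fderiv ℝ G z = A

/-- A real function is *nonlinear* if it is not of the form `t ↦ k * t`. -/
def NonlinearFun (ψ : ℝ → ℝ) : Prop :=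
  ¬ ∃ k : ℝ, ∀ t : ℝ, ψ t = k * t

/-- The linear rotation by angle `θ`. -/
noncomputable def Rot (θ : ℝ) (p : ℝ × ℝ) : ℝ × ℝ :=
  (p.1 * Real.cos θ - p.2 * Real.sin θ, p.1 * Real.sin θ + p.2 * Real.cos θ)

/-- The pair `(p, q)` is a `C¹` gradient field on the plane, with partial derivatives
`p_x = a`, `p_y = q_x = b`, `q_y = d`, whose Jacobian is singular everywhere. -/
structure IsDegenerateGradient (p q a b d : ℝ × ℝ → ℝ) : Prop where
  hasFDerivAt_fst : ∀ z, HasFDerivAt p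
    (a z • ContinuousLinearMap.fst ℝ ℝ ℝ + b z • ContinuousLinearMap.snd ℝ ℝ ℝ) z
  hasFDerivAt_snd : ∀ z, HasFDerivAt q
    (b z • ContinuousLinearMap.fst ℝ ℝ ℝ + d z • ContinuousLinearMap.snd ℝ ℝ ℝ) z
  continuous_a : Continuous a
  continuous_b : Continuous b
  continuous_d : Continuous d
  det_eq_zero : ∀ z, a z * d z = b z ^ 2

/-- The invertible linear map `(u, v) ↦ (a * u + b * v, v)`. -/
noncomputable def shearEquiv (a b : ℝ) (ha : a ≠ 0) : (ℝ × ℝ) ≃L[ℝ] (ℝ × ℝ) :=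
  ContinuousLinearEquiv.equivOfInverse
    ((a • ContinuousLinearMap.fst ℝ ℝ ℝ + b • ContinuousLinearMap.snd ℝ ℝ ℝ).prod
      (ContinuousLinearMap.snd ℝ ℝ ℝ))
    ((a⁻¹ • ContinuousLinearMap.fst ℝ ℝ ℝ + (-(b / a)) • ContinuousLinearMap.snd ℝ ℝ ℝ).prod
      (ContinuousLinearMap.snd ℝ ℝ ℝ))
    (fun z => by ext <;> simp; field_simp; ring)
    (fun z => by ext <;> simp; field_simp; ring)

lemma eq_of_hasDerivAt_const {f : ℝ → ℝ} {c y₀ r : ℝ}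
    (hf : ∀ y ∈ Metric.ball y₀ r, HasDerivAt f c y) {y : ℝ} (hy : y ∈ Metric.ball y₀ r) :
    f y = f y₀ + c * (y - y₀) := by
  have hr : y₀ ∈ Metric.ball y₀ r := Metric.mem_ball_self (Metric.pos_of_mem_ball hy)
  have hg : ∀ x ∈ Metric.ball y₀ r, HasDerivAt (fun x => f x - c * x) 0 x := by
    intro x hx
    exact ((hf x hx).sub ((hasDerivAt_id' x).const_mul c)).congr_deriv (by simp)
  have := Metric.isOpen_ball.is_const_of_deriv_eq_zero
    (convex_ball y₀ r).isPreconnected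
    (fun x hx => (hg x hx).differentiableAt.differentiableWithinAt)
    (fun x hx => (hg x hx).deriv) hy hr
  linarith

namespace IsDegenerateGradient

variable {p q a b d : ℝ × ℝ → ℝ}

lemma contDiff_fst (h : IsDegenerateGradient p q a b d) : ContDiff ℝ 1 p := by
  rw [contDiff_one_iff_fderiv]
  refine ⟨fun z => (h.hasFDerivAt_fst z).differentiableAt, ?_⟩
  rw [funext fun z => (h.hasFDerivAt_fst z).fderiv]
  exact (h.continuous_a.smul continuous_const).add (h.continuous_b.smul continuous_const)

/-- Coordinates `(s, y) ↦ (X s y, y)` near a point where `p_x ≠ 0`, straightening the level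
sets of `p`. -/
lemma exists_local_coords (h : IsDegenerateGradient p q a b d) {z₀ : ℝ × ℝ} (hz : a z₀ ≠ 0) :
    ∃ X : ℝ × ℝ → ℝ, ∃ r > 0, X (p z₀, z₀.2) = z₀.1 ∧
      ∀ s ∈ Metric.ball (p z₀) r, ∀ y ∈ Metric.ball z₀.2 r,
        a (X (s, y), y) ≠ 0 ∧
        HasFDerivAt X ((a (X (s, y), y))⁻¹ • ContinuousLinearMap.fst ℝ ℝ ℝ +
          (-(b (X (s, y), y) / a (X (s, y), y))) • ContinuousLinearMap.snd ℝ ℝ ℝ) (s, y) := by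
  set Φ : ℝ × ℝ → ℝ × ℝ := fun z => (p z, z.2) with hΦ
  have hd : ∀ z (hz : a z ≠ 0),
      HasFDerivAt Φ (shearEquiv (a z) (b z) hz : (ℝ × ℝ) →L[ℝ] ℝ × ℝ) z := fun z hz =>
    (h.hasFDerivAt_fst z).prodMk _root_.hasFDerivAt_snd
  have hc : ContDiffAt ℝ 1 Φ z₀ := (h.contDiff_fst.prodMk contDiff_snd).contDiffAt
  let e := hc.toOpenPartialHomeomorph Φ (hd z₀ hz) one_ne_zero
  have he : ∀ z, e z = Φ z := fun z => rfl
  have hzs : z₀ ∈ e.source := hc.mem_toOpenPartialHomeomorph_source (hd z₀ hz) one_ne_zero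
  have hopen : IsOpen (e.target ∩ e.symm ⁻¹' {z | a z ≠ 0}) :=
    e.isOpen_inter_preimage_symm (isOpen_ne_fun h.continuous_a continuous_const)
  have hsymm : e.symm (p z₀, z₀.2) = z₀ := e.left_inv hzs
  have hmem : (p z₀, z₀.2) ∈ e.target ∩ e.symm ⁻¹' {z | a z ≠ 0} :=
    ⟨e.map_source hzs, by simpa [hsymm] using hz⟩
  obtain ⟨r, hr, hball⟩ := Metric.isOpen_iff.1 hopen _ hmem
  refine ⟨fun w => (e.symm w).1, r, hr, by simp [hsymm], fun s hs y hy => ?_⟩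
  have hw : (s, y) ∈ e.target ∩ e.symm ⁻¹' {z | a z ≠ 0} := by
    apply hball
    rw [← ball_prod_same]
    exact ⟨hs, hy⟩
  have hsnd : (e.symm (s, y)).2 = y := by
    have := e.right_inv hw.1
    rw [he] at this
    exact congrArg Prod.snd this
  have hpt : ((e.symm (s, y)).1, y) = e.symm (s, y) := Prod.ext rfl hsnd.symm
  simp only [hpt]
  have ha : a (e.symm (s, y)) ≠ 0 := hw.2
  refine ⟨ha, ?_⟩
  have := e.hasFDerivAt_symm hw.1 (hd _ ha)
  exact this.fst

/-- Near a point where `p_x ≠ 0`, the kernel direction of the Jacobian is constant along the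
kernel line through the point, and `1 / p_x` is affine along it. -/
lemma exists_local_line (h : IsDegenerateGradient p q a b d) {z₀ : ℝ × ℝ} (hz : a z₀ ≠ 0)
    {m : ℝ} (hm : b z₀ = -m * a z₀) :
    ∃ ε > 0, ∃ k c : ℝ, ∀ t, |t| < ε →
      a (z₀.1 + m * t, z₀.2 + t) * (k + c * t) = 1 ∧
      b (z₀.1 + m * t, z₀.2 + t) = -m * a (z₀.1 + m * t, z₀.2 + t) := by
  obtain ⟨X, r, hr, hX0, hX⟩ := h.exists_local_coords hz
  set s₀ := p z₀
  set y₀ := z₀.2 with hy₀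
  have hs₀ : s₀ ∈ Metric.ball s₀ r := Metric.mem_ball_self hr
  have hyy : y₀ ∈ Metric.ball y₀ r := Metric.mem_ball_self hr
  set β : ℝ → ℝ → ℝ := fun s y => b (X (s, y), y) / a (X (s, y), y) with hβ
  have hXs : ∀ s ∈ Metric.ball s₀ r, ∀ y ∈ Metric.ball y₀ r,
      HasDerivAt (fun s => X (s, y)) (a (X (s, y), y))⁻¹ s := by
    intro s hs y hy
    exact ((hX s hs y hy).2.comp_hasDerivAt (f := fun s => (s, y)) s
      ((hasDerivAt_id' s).prodMk (hasDerivAt_const s y))).congr_deriv (by simp)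
  have hXy : ∀ s ∈ Metric.ball s₀ r, ∀ y ∈ Metric.ball y₀ r,
      HasDerivAt (fun y => X (s, y)) (-β s y) y := by
    intro s hs y hy
    exact ((hX s hs y hy).2.comp_hasDerivAt (f := fun y => (s, y)) y
      ((hasDerivAt_const y s).prodMk (hasDerivAt_id' y))).congr_deriv (by simp [hβ])
  have hQs : ∀ s ∈ Metric.ball s₀ r, ∀ y ∈ Metric.ball y₀ r,
      HasDerivAt (fun s => q (X (s, y), y)) (β s y) s := by
    intro s hs y hy
    exact ((h.hasFDerivAt_snd (X (s, y), y)).comp_hasDerivAt (f := fun s => (X (s, y), y)) s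
      ((hXs s hs y hy).prodMk (hasDerivAt_const s y))).congr_deriv
      (by simp [hβ, div_eq_mul_inv])
  have hQy : ∀ s ∈ Metric.ball s₀ r, ∀ y ∈ Metric.ball y₀ r,
      HasDerivAt (fun y => q (X (s, y), y)) 0 y := by
    intro s hs y hy
    have h2 := h.det_eq_zero (X (s, y), y)
    have h3 := (hX s hs y hy).1
    refine ((h.hasFDerivAt_snd (X (s, y), y)).comp_hasDerivAt (f := fun y => (X (s, y), y)) y
      ((hXy s hs y hy).prodMk (hasDerivAt_id' y))).congr_deriv ?_
    simp [hβ]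
    field_simp
    linarith
  have hβc : ∀ s ∈ Metric.ball s₀ r, ∀ y ∈ Metric.ball y₀ r, β s y = β s y₀ := by
    intro s hs y hy
    refine (hQs s hs y hy).unique ((hQs s hs y₀ hyy).congr_of_eventuallyEq ?_)
    filter_upwards [Metric.isOpen_ball.mem_nhds hs] with s' hs'
    simpa using eq_of_hasDerivAt_const (hQy s' hs') hy
  have hXaff : ∀ s ∈ Metric.ball s₀ r, ∀ t, |t| < r →
      X (s, y₀ + t) = X (s, y₀) - β s y₀ * t := by
    intro s hs t ht
    have := eq_of_hasDerivAt_const (f := fun y => X (s, y)) (c := -β s y₀) (y₀ := y₀) (r := r)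
      (fun y hy => hβc s hs y hy ▸ hXy s hs y hy) (y := y₀ + t) (by simpa using ht)
    rw [this]; ring
  have hz₀ : (X (s₀, y₀), y₀) = z₀ := Prod.ext hX0 rfl
  have hβ0 : β s₀ y₀ = -m := by
    simp only [hβ, hz₀, hm]
    field_simp
  have hline : ∀ t, |t| < r → (X (s₀, y₀ + t), y₀ + t) = (z₀.1 + m * t, y₀ + t) := by
    intro t ht
    rw [hXaff s₀ hs₀ t ht, hβ0, hX0]
    congr 1; ring
  have hmem : ∀ t, |t| < r → y₀ + t ∈ Metric.ball y₀ r := fun t ht => by simpa using ht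
  have hr2 : |r / 2| < r := by rw [abs_of_pos (by positivity)]; linarith
  set k₀ := (a (X (s₀, y₀), y₀))⁻¹
  set k₁ := (a (X (s₀, y₀ + r / 2), y₀ + r / 2))⁻¹
  refine ⟨r, hr, k₀, (k₁ - k₀) / (r / 2), fun t ht => ?_⟩
  have hne := (hX s₀ hs₀ _ (hmem t ht)).1
  have h1 := hβc s₀ hs₀ _ (hmem t ht)
  rw [hβ0] at h1
  simp only [hβ] at h1
  have h2 : (a (X (s₀, y₀ + t), y₀ + t))⁻¹ = k₀ + t / (r / 2) * (k₁ - k₀) := by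
    refine (hXs s₀ hs₀ _ (hmem t ht)).unique (HasDerivAt.congr_of_eventuallyEq
      ((hXs s₀ hs₀ _ hyy).add
      (((hXs s₀ hs₀ _ (hmem _ hr2)).sub (hXs s₀ hs₀ _ hyy)).const_mul (t / (r / 2)))) ?_)
    filter_upwards [Metric.isOpen_ball.mem_nhds hs₀] with s hs
    simp only [Pi.add_apply, Pi.sub_apply]
    rw [hXaff s hs t ht, hXaff s hs _ hr2]
    field_simp
    ring
  rw [hline t ht] at h1 h2 hne
  refine ⟨?_, by field_simp at h1; linarith⟩
  rw [show k₀ + (k₁ - k₀) / (r / 2) * t = k₀ + t / (r / 2) * (k₁ - k₀) by ring, ← h2]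
  exact mul_inv_cancel₀ hne

/-- The kernel line through a point where `p_x ≠ 0` consists of such points, with the same
kernel direction. -/
lemma line (h : IsDegenerateGradient p q a b d) {z₀ : ℝ × ℝ} (hz : a z₀ ≠ 0)
    {m : ℝ} (hm : b z₀ = -m * a z₀) (t : ℝ) :
    a (z₀.1 + m * t, z₀.2 + t) ≠ 0 ∧
      b (z₀.1 + m * t, z₀.2 + t) = -m * a (z₀.1 + m * t, z₀.2 + t) := by
  obtain ⟨ε, hε, k, c, hloc⟩ := h.exists_local_line hz hm
  set γ : ℝ → ℝ × ℝ := fun t => (z₀.1 + m * t, z₀.2 + t) with hγ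
  have hγc : Continuous γ := by fun_prop
  set P : ℝ → Prop := fun t => a (γ t) * (k + c * t) = 1 ∧ b (γ t) = -m * a (γ t) with hP
  have hPclosed : IsClosed {t | P t} := by
    have := h.continuous_a
    have := h.continuous_b
    exact (isClosed_eq (by fun_prop) continuous_const).inter
      (isClosed_eq (by fun_prop) (by fun_prop))
  set S : Set ℝ := {t | ∀ᶠ s in 𝓝 t, P s} with hS
  have hSP : ∀ t ∈ S, P t := fun t ht => ht.self_of_nhds
  have hSclosed : IsClosed S := by
    refine isClosed_of_closure_subset fun t ht => ?_
    have hPt : P t := closure_minimal hSP hPclosed ht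
    have hat : a (γ t) ≠ 0 := left_ne_zero_of_mul_eq_one hPt.1
    obtain ⟨δ, hδ, k₁, c₁, hloc₁⟩ := h.exists_local_line hat hPt.2
    have hloc' : ∀ s, |s - t| < δ → a (γ s) * (k₁ + c₁ * (s - t)) = 1 ∧
        b (γ s) = -m * a (γ s) := by
      intro s hs
      have h1 : ((γ t).1 + m * (s - t), (γ t).2 + (s - t)) = γ s := by
        ext <;> simp only [hγ] <;> ring
      simpa only [h1] using hloc₁ (s - t) hs
    obtain ⟨u, huS, hut⟩ := Metric.mem_closure_iff.1 ht δ hδ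
    have hagree : ∀ᶠ s in 𝓝 u, k + c * s = k₁ + c₁ * (s - t) := by
      have hnear : ∀ᶠ s in 𝓝 u, |s - t| < δ := by
        refine (isOpen_lt (by fun_prop) continuous_const).mem_nhds ?_
        rwa [dist_comm, Real.dist_eq] at hut
      filter_upwards [huS, hnear] with s hs hs'
      exact mul_left_cancel₀ (left_ne_zero_of_mul_eq_one hs.1) (hs.1.trans (hloc' s hs').1.symm)
    have hu := hagree.self_of_nhds
    obtain ⟨v, hv, hvu⟩ := ((hagree.filter_mono nhdsWithin_le_nhds).and
      (self_mem_nhdsWithin (s := {u}ᶜ))).exists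
    have hcc : c = c₁ := by
      have : (c - c₁) * (v - u) = 0 := by linarith
      rcases mul_eq_zero.1 this with h0 | h0
      · linarith
      · exact absurd (sub_eq_zero.1 h0) hvu
    have hnear : ∀ᶠ s in 𝓝 t, |s - t| < δ := by
      refine (isOpen_lt (by fun_prop) continuous_const).mem_nhds ?_
      simpa using hδ
    filter_upwards [hnear] with s hs
    have := hloc' s hs
    refine ⟨?_, this.2⟩
    rw [← this.1]
    subst hcc
    congr 1; linarith
  have h0 : (0 : ℝ) ∈ S := by
    filter_upwards [Metric.ball_mem_nhds (0 : ℝ) hε] with s hs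
    exact hloc s (by simpa using hs)
  have huniv : S = Set.univ := IsClopen.eq_univ ⟨hSclosed, isOpen_setOfPred_eventually_nhds⟩ ⟨0, h0⟩
  have := hSP t (huniv ▸ Set.mem_univ t)
  exact ⟨left_ne_zero_of_mul_eq_one this.1, this.2⟩

lemma swap (h : IsDegenerateGradient p q a b d) :
    IsDegenerateGradient (q ∘ Prod.swap) (p ∘ Prod.swap) (d ∘ Prod.swap) (b ∘ Prod.swap)
      (a ∘ Prod.swap) where
  hasFDerivAt_fst z := by
    refine ((h.hasFDerivAt_snd z.swap).comp z
      (ContinuousLinearEquiv.prodComm ℝ ℝ ℝ).hasFDerivAt).congr_fderiv ?_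
    ext <;> simp
  hasFDerivAt_snd z := by
    refine ((h.hasFDerivAt_fst z.swap).comp z
      (ContinuousLinearEquiv.prodComm ℝ ℝ ℝ).hasFDerivAt).congr_fderiv ?_
    ext <;> simp
  continuous_a := h.continuous_d.comp continuous_swap
  continuous_b := h.continuous_b.comp continuous_swap
  continuous_d := h.continuous_a.comp continuous_swap
  det_eq_zero z := by simpa [mul_comm] using h.det_eq_zero z.swap

/-- If `p_x ≠ 0` somewhere, the kernel of the Jacobian contains the same line everywhere. -/
lemma kernel_const (h : IsDegenerateGradient p q a b d) {z₁ : ℝ × ℝ} (hz : a z₁ ≠ 0) :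
    ∃ m : ℝ, ∀ z, b z = -m * a z ∧ d z = -m * b z := by
  set m := -(b z₁ / a z₁) with hm
  have hm₁ : b z₁ = -m * a z₁ := by rw [hm]; field_simp
  refine ⟨m, fun z => ?_⟩
  have hdet := h.det_eq_zero z
  by_cases ha : a z = 0
  · have hb : b z = 0 := by simpa [ha] using hdet.symm
    by_cases hd : d z = 0
    · simp [ha, hb, hd]
    · exfalso
      have h1 := (h.swap.line (z₀ := z.swap) (m := 0) (by simpa using hd) (by simpa using hb)
        (z₁.1 + m * (z.2 - z₁.2) - z.1)).2
      have h2 := h.line hz hm₁ (z.2 - z₁.2)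
      have h3 := h.swap.det_eq_zero (z.swap.1 + 0 * (z₁.1 + m * (z.2 - z₁.2) - z.1),
        z.swap.2 + (z₁.1 + m * (z.2 - z₁.2) - z.1))
      have h4 := (h.swap.line (z₀ := z.swap) (m := 0) (by simpa using hd) (by simpa using hb)
        (z₁.1 + m * (z.2 - z₁.2) - z.1)).1
      simp at h1 h2 h3 h4
      rw [h1] at h3
      simp [h2.1, h4] at h3
  · obtain ⟨m', hm'⟩ : ∃ m', b z = -m' * a z := ⟨-(b z / a z), by field_simp⟩
    have hmm : m' = m := by
      by_contra hne
      have hne' : m' - m ≠ 0 := sub_ne_zero.2 hne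
      set y := (z₁.1 - z.1 - m * z₁.2 + m' * z.2) / (m' - m) with hy
      have hy' : z.1 + m' * (y - z.2) = z₁.1 + m * (y - z₁.2) := by
        have : (m' - m) * y = z₁.1 - z.1 - m * z₁.2 + m' * z.2 := by rw [hy]; field_simp
        linarith
      have h1 := h.line hz hm₁ (y - z₁.2)
      have h2 := h.line ha hm' (y - z.2)
      rw [hy'] at h2
      simp only [add_sub_cancel] at h1 h2
      apply hne
      have := h1.2.symm.trans h2.2
      have := mul_right_cancel₀ h1.1 this
      linarith
    subst hmm
    refine ⟨hm', mul_left_cancel₀ ha ?_⟩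
    rw [hdet, hm']; ring

/-- A degenerate gradient field on the whole plane is constant along a family of parallel
lines, and takes values in a line orthogonal to them. -/
lemma cylinder (h : IsDegenerateGradient p q a b d) :
    (∃ m c : ℝ, ∀ z, q z = c - m * p z ∧ p z = p (z.1 - m * z.2, 0)) ∨
    (∃ c : ℝ, ∀ z, p z = c ∧ q z = q (0, z.2)) := by
  by_cases hex : ∃ z, a z ≠ 0
  · left
    obtain ⟨z₁, hz₁⟩ := hex
    obtain ⟨m, hm⟩ := h.kernel_const hz₁
    refine ⟨m, q 0 + m * p 0, fun z => ⟨?_, ?_⟩⟩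
    · have hd : ∀ z, HasFDerivAt (fun z => q z + m * p z) (0 : ℝ × ℝ →L[ℝ] ℝ) z := by
        intro z
        refine ((h.hasFDerivAt_snd z).add ((h.hasFDerivAt_fst z).const_mul m)).congr_fderiv ?_
        ext <;> simp [hm z]
      have := is_const_of_fderiv_eq_zero (fun z => (hd z).differentiableAt)
        (fun z => (hd z).fderiv) z 0
      linarith
    · have hd : ∀ y, HasDerivAt (fun y => p (z.1 - m * z.2 + m * y, y)) 0 y := by
        intro y
        refine ((h.hasFDerivAt_fst (z.1 - m * z.2 + m * y, y)).comp_hasDerivAt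
          (f := fun y => (z.1 - m * z.2 + m * y, y)) y
          ((((hasDerivAt_id' y).const_mul m).const_add (z.1 - m * z.2)).prodMk
            (hasDerivAt_id' y))).congr_deriv ?_
        simp [hm (z.1 - m * z.2 + m * y, y)]
        ring
      have := is_const_of_deriv_eq_zero (fun y => (hd y).differentiableAt)
        (fun y => (hd y).deriv) z.2 0
      simpa using this
  · right
    push Not at hex
    have hb : ∀ z, b z = 0 := fun z => by simpa [hex z] using (h.det_eq_zero z).symm
    refine ⟨p 0, fun z => ⟨?_, ?_⟩⟩
    · have hd : ∀ z, HasFDerivAt p (0 : ℝ × ℝ →L[ℝ] ℝ) z := by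
        intro z
        simpa [hex, hb] using h.hasFDerivAt_fst z
      exact is_const_of_fderiv_eq_zero (fun z => (hd z).differentiableAt)
        (fun z => (hd z).fderiv) z 0
    · have hd : ∀ x, HasDerivAt (fun x => q (x, z.2)) 0 x := by
        intro x
        exact ((h.hasFDerivAt_snd (x, z.2)).comp_hasDerivAt (f := fun x => (x, z.2)) x
          ((hasDerivAt_id' x).prodMk (hasDerivAt_const x z.2))).congr_deriv (by simp [hb])
      exact is_const_of_deriv_eq_zero (fun y => (hd y).differentiableAt)
        (fun y => (hd y).deriv) z.1 0

end IsDegenerateGradient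

/-- The cohomological equation `u (s + 1) - u s = f s` for `f` vanishing on `s ≤ 0`. -/
lemma exists_continuous_primitive_of_eq_zero {f : ℝ → ℝ} (hf : Continuous f)
    (h0 : ∀ s ≤ 0, f s = 0) : ∃ u : ℝ → ℝ, Continuous u ∧ ∀ s, u (s + 1) = u s + f s := by
  set S : ℕ → ℝ → ℝ := fun N s => ∑ n ∈ Finset.range N, f (s - (n + 1)) with hS
  have hSc : ∀ N, Continuous (S N) := fun N => by simp only [hS]; fun_prop
  have hstab : ∀ N M : ℕ, ∀ s : ℝ, s ≤ N → N ≤ M → S M s = S N s := by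
    intro N M s hs hNM
    refine (Finset.sum_subset (Finset.range_mono hNM) fun n _ hn => h0 _ ?_).symm
    have : (N : ℝ) ≤ n := by simpa using hn
    linarith
  have hu : ∀ N : ℕ, ∀ s : ℝ, s ≤ N → S ⌈s⌉₊ s = S N s := fun N s hs =>
    (hstab _ _ s (Nat.le_ceil s) (Nat.ceil_le.2 hs)).symm
  refine ⟨fun s => S ⌈s⌉₊ s, continuous_iff_continuousAt.2 fun s => ?_, fun s => ?_⟩
  · obtain ⟨N, hN⟩ := exists_nat_gt s
    refine (hSc N).continuousAt.congr ?_
    filter_upwards [Iio_mem_nhds hN] with t ht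
    exact (hu N t (le_of_lt ht)).symm
  · obtain ⟨N, hN⟩ := exists_nat_gt s
    simp only
    rw [hu (N + 1) (s + 1) (by push_cast; linarith), hu N s hN.le]
    simp only [hS]
    rw [Finset.sum_range_succ']
    congr 1
    · refine Finset.sum_congr rfl fun n _ => ?_
      congr 1; push_cast; ring
    · simp

lemma exists_continuous_primitive {f : ℝ → ℝ} (hf : Continuous f) :
    ∃ u : ℝ → ℝ, Continuous u ∧ ∀ s, u (s + 1) = u s + f s := by
  set ρ : ℝ → ℝ := fun s => max 0 (min s 1) with hρ
  have hρc : Continuous ρ := by fun_prop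
  obtain ⟨u, hu, hu'⟩ := exists_continuous_primitive_of_eq_zero (f := fun s => ρ s * f s)
    (by fun_prop) (fun s hs => by simp [hρ, hs])
  obtain ⟨v, hv, hv'⟩ := exists_continuous_primitive_of_eq_zero
    (f := fun s => (1 - ρ (1 - s)) * f (1 - s))
    (by fun_prop) (fun s hs => by simp [hρ, hs])
  refine ⟨fun s => u s - v (2 - s), by fun_prop, fun s => ?_⟩
  have h1 := hu' s
  have h2 := hv' (1 - s)
  simp only [sub_sub_cancel] at h2
  rw [show 1 - s + 1 = 2 - s by ring] at h2
  simp only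
  rw [h1, show 2 - (s + 1) = 1 - s by ring, h2]
  ring

/-- A fixed point free skew translation of the plane is conjugate to a translation. -/
lemma exists_conj_skew_translation {c : ℝ} {ψ : ℝ → ℝ} (hψ : Continuous ψ)
    (hfree : c = 0 → ∀ s, ψ s ≠ 0) :
    ∃ φ : (ℝ × ℝ) ≃ₜ (ℝ × ℝ), ∀ s t : ℝ,
      φ (s + c, t + ψ s) = ((φ (s, t)).1 + 1, (φ (s, t)).2) := by
  by_cases hc : c = 0
  · have hne := hfree hc
    subst hc
    refine ⟨{ toFun := fun z => (z.2 / ψ z.1, z.1)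
              invFun := fun z => (z.2, z.1 * ψ z.2)
              left_inv := fun z => by ext <;> simp [hne]
              right_inv := fun z => by ext <;> simp [hne]
              continuous_toFun := ?_
              continuous_invFun := by fun_prop }, fun s t => ?_⟩
    · exact (continuous_snd.div (by fun_prop) fun z => hne _).prodMk continuous_fst
    · have := hne s
      ext
      · simp
        field_simp
      · simp
  · obtain ⟨u, hu, hu'⟩ := exists_continuous_primitive (f := fun s => ψ (c * s)) (by fun_prop)
    refine ⟨{ toFun := fun z => (z.1 / c, z.2 - u (z.1 / c))
              invFun := fun z => (z.1 * c, z.2 + u z.1)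
              left_inv := fun z => by ext <;> simp [hc]
              right_inv := fun z => by ext <;> simp [hc]
              continuous_toFun := by fun_prop
              continuous_invFun := by fun_prop }, fun s t => ?_⟩
    have h1 : (s + c) / c = s / c + 1 := by field_simp
    have h2 : c * (s / c) = s := by field_simp
    ext
    · simp [h1]
    · simp [h1, hu', h2]

lemma Unipotent.isDegenerateGradient {G : ℝ × ℝ → ℝ × ℝ} (hG : ContDiff ℝ 1 G)
    (hU : Unipotent G) :
    IsDegenerateGradient (fun z => z.2 - (G z).2) (fun z => (G z).1 - z.1)
      (fun z => -(fderiv ℝ G z (1, 0)).2) (fun z => (fderiv ℝ G z (1, 0)).1 - 1)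
      (fun z => (fderiv ℝ G z (0, 1)).1) := by
  have hd : ∀ z, HasFDerivAt G (fderiv ℝ G z) z := fun z =>
    (hG.differentiable one_ne_zero z).hasFDerivAt
  have hc : Continuous (fderiv ℝ G) := hG.continuous_fderiv one_ne_zero
  refine ⟨fun z => ?_, fun z => ?_, by fun_prop, by fun_prop, by fun_prop, fun z => ?_⟩
  · have htr := (hU z).1
    refine (hasFDerivAt_snd.sub (hd z).snd).congr_fderiv ?_
    ext
    · simp
    · simp
      linarith
  · refine ((hd z).fst.sub hasFDerivAt_fst).congr_fderiv ?_
    ext <;> simp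
  · obtain ⟨h1, h2⟩ := hU z
    have h3 : (fderiv ℝ G z (0, 1)).2 = 2 - (fderiv ℝ G z (1, 0)).1 := by linarith
    rw [h3] at h2
    linarith

/-- a fixed point free `C¹` unipotent map is topologically conjugate to
the translation `τ (x, y) = (x + 1, y)`. -/
theorem statement13 (G : ℝ × ℝ → ℝ × ℝ) (hG : ContDiff ℝ 1 G) (hU : Unipotent G)
    (hfree : ∀ z : ℝ × ℝ, G z ≠ z) :
    ∃ φ : (ℝ × ℝ) ≃ₜ (ℝ × ℝ),
      ∀ z : ℝ × ℝ, φ (G z) = ((φ z).1 + 1, (φ z).2) := by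
  suffices hskew : ∃ (e : (ℝ × ℝ) ≃ₜ (ℝ × ℝ)) (c : ℝ) (ψ : ℝ → ℝ), Continuous ψ ∧
      ∀ z, e (G z) = ((e z).1 + c, (e z).2 + ψ (e z).1) by
    obtain ⟨e, c, ψ, hψ, he⟩ := hskew
    obtain ⟨φ, hφ⟩ := exists_conj_skew_translation (c := c) hψ (by
      rintro rfl s hs
      refine hfree (e.symm (s, 0)) (e.injective ?_)
      simp [he, hs])
    exact ⟨e.trans φ, fun z => by simp [he, hφ]⟩
  have hGc := hG.continuous
  rcases (hU.isDegenerateGradient hG).cylinder with ⟨m, c, h⟩ | ⟨c, h⟩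
  · refine ⟨{ toFun := fun z => (z.1 - m * z.2, z.2)
              invFun := fun z => (z.1 + m * z.2, z.2)
              left_inv := fun z => by simp
              right_inv := fun z => by simp
              continuous_toFun := by fun_prop
              continuous_invFun := by fun_prop }, c, fun s => (G (s, 0)).2, by fun_prop,
      fun z => ?_⟩
    obtain ⟨h1, h2⟩ := h z
    ext <;> simp <;> linarith
  · refine ⟨Homeomorph.prodComm ℝ ℝ, -c, fun s => (G (0, s)).1, by fun_prop, fun z => ?_⟩
    obtain ⟨h1, h2⟩ := h z
    ext <;> simp <;> linarith
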